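/- Each of the eight self-dual 4-forms ω₁ = cay, ω₂, ω₃, ω₄, η₁, η₂, η₃, η₄ on ℝ⁸ has comass exactly 1. -/

import Mathlib

noncomputable section

open scoped BigOperators
open Matrix

/-- `ℝ⁸` with its standard Euclidean structure. -/
abbrev E8 : Type := EuclideanSpace ℝ (Fin 8)

/-- The standard orthonormal basis `e₁, …, e₈` of `ℝ⁸`. -/
def stdB : Fin 8 → E8 := fun i => EuclideanSpace.single i 1

/-- The `j`-th coordinate functional `eʲ`. -/
def coordL (j : Fin 8) : E8 →ₗ[ℝ] ℝ :=
  (LinearMap.proj j).comp (WithLp.linearEquiv 2 ℝ (Fin 8 → ℝ)).toLinearMap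

/-- Alternating 4-forms on `ℝ⁸`. -/
abbrev Form4 : Type := AlternatingMap ℝ E8 ℝ (Fin 4)

/-- The decomposable 4-form `eᵃ∧eᵇ∧eᶜ∧eᵈ` (value `det` of the coordinates). -/
def wedge4 (a b c d : Fin 8) : Form4 :=
  (Matrix.detRowAlternating : AlternatingMap ℝ (Fin 4 → ℝ) ℝ (Fin 4)).compLinearMap
    (LinearMap.pi (fun i : Fin 4 => coordL (![a, b, c, d] i)))

/-- The comass `‖ω‖` of a 4-form: the sup of values on unit vectors. -/
def comass (ω : Form4) : ℝ :=
  sSup {r : ℝ | ∃ v : Fin 4 → E8, (∀ i, ‖v i‖ = 1) ∧ ω v = r}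

open scoped Classical in
/-- The square `|ω|²` of the Euclidean norm of a 4-form:
the sum of the squares of the coefficients over increasing multi-indices. -/
def eNormSq (ω : Form4) : ℝ :=
  ∑ f ∈ Finset.univ.filter (fun f : Fin 4 → Fin 8 => StrictMono f),
    (ω (fun i => stdB (f i))) ^ 2

/-- `e^{1234}` (1-indexed), i.e. `e¹∧e²∧e³∧e⁴` plus its Hodge dual. -/
def E1234 : Form4 := wedge4 0 1 2 3 + wedge4 4 5 6 7
def E1256 : Form4 := wedge4 0 1 4 5 + wedge4 2 3 6 7
def E1278 : Form4 := wedge4 0 1 6 7 + wedge4 2 3 4 5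
def E1357 : Form4 := wedge4 0 2 4 6 + wedge4 1 3 5 7
def E1467 : Form4 := wedge4 0 3 5 6 + wedge4 1 2 4 7
def E1368 : Form4 := wedge4 0 2 5 7 + wedge4 1 3 4 6
def E1458 : Form4 := wedge4 0 3 4 7 + wedge4 1 2 5 6

/-- The Cayley form. -/
def cay : Form4 := E1234 + E1256 + E1278 + E1357 - E1368 - E1458 - E1467

/-- A 4-form on `ℝ⁸` is self-dual if `ω(e_f) = ω(e_g)` whenever `f`, `g` are complementary
increasing multi-indices whose concatenation is an even permutation of `(1,…,8)`
(i.e. induces the standard orientation). -/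
def SelfDual (ω : Form4) : Prop :=
  ∀ (f g : Fin 4 → Fin 8) (σ : Equiv.Perm (Fin 8)),
    StrictMono f → StrictMono g →
    (∀ i : Fin 8, σ i = Fin.append f g (Fin.cast (by norm_num) i)) →
    Equiv.Perm.sign σ = 1 →
    ω (fun i => stdB (f i)) = ω (fun i => stdB (g i))

/-- Membership in `SO(8)`, as real `8 × 8` matrices. -/
def IsSO8 (g : Matrix (Fin 8) (Fin 8) ℝ) : Prop := g * gᵀ = 1 ∧ g.det = 1

/-- The linear action of an `8 × 8` matrix on `ℝ⁸`. -/
def mulVecL (g : Matrix (Fin 8) (Fin 8) ℝ) : E8 →ₗ[ℝ] E8 :=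
  (WithLp.linearEquiv 2 ℝ (Fin 8 → ℝ)).symm.toLinearMap ∘ₗ
    g.mulVecLin ∘ₗ (WithLp.linearEquiv 2 ℝ (Fin 8 → ℝ)).toLinearMap

/-- The action of a matrix `g` on 4-forms: `(g·ω)(v₁,…,v₄) = ω(g⁻¹v₁,…,g⁻¹v₄)`. -/
def formAct (g : Matrix (Fin 8) (Fin 8) ℝ) (ω : Form4) : Form4 :=
  ω.compLinearMap (mulVecL g⁻¹)

/-- Two 4-forms are `SO(8)`-conjugate if they lie in the same orbit. -/
def SOConj (ω η : Form4) : Prop := ∃ g, IsSO8 g ∧ formAct g ω = η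

/-- `ω₂` from Proposition `morecomassone`. -/
def omega2 : Form4 := E1234 + E1256 + E1278 - E1357 + E1467 + E1368 + E1458
def omega3 : Form4 := E1234 - E1256 - E1278 + E1357 + E1467 - E1368 + E1458
def omega4 : Form4 := E1234 - E1256 - E1278 - E1357 - E1467 + E1368 - E1458
def eta1 : Form4 := E1234 - E1256 + E1278 + E1357 + E1467 + E1368 - E1458
def eta2 : Form4 := E1234 - E1256 + E1278 - E1357 - E1467 - E1368 + E1458
def eta3 : Form4 := E1234 + E1256 - E1278 + E1357 - E1467 + E1368 + E1458
def eta4 : Form4 := E1234 + E1256 - E1278 - E1357 + E1467 - E1368 - E1458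

/-- The eight comass-one self-dual forms `ω₁ = cay, ω₂, ω₃, ω₄, η₁, η₂, η₃, η₄`. -/
def forms8 : Fin 8 → Form4 := ![cay, omega2, omega3, omega4, eta1, eta2, eta3, eta4]

/-- The octonion product on `ℝ⁸` associated with the Cayley form, with unit `e₁`. -/
def octMul (y w : E8) : E8 :=
  !₂[y 0 * w 0 - y 1 * w 1 - y 2 * w 2 - y 3 * w 3 - y 4 * w 4 - y 5 * w 5 - y 6 * w 6 - y 7 * w 7,
    y 0 * w 1 + y 1 * w 0 + y 2 * w 3 - y 3 * w 2 + y 4 * w 5 - y 5 * w 4 + y 6 * w 7 - y 7 * w 6,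
    y 0 * w 2 - y 1 * w 3 + y 2 * w 0 + y 3 * w 1 + y 4 * w 6 - y 5 * w 7 - y 6 * w 4 + y 7 * w 5,
    y 0 * w 3 + y 1 * w 2 - y 2 * w 1 + y 3 * w 0 - y 4 * w 7 - y 5 * w 6 + y 6 * w 5 + y 7 * w 4,
    y 0 * w 4 - y 1 * w 5 - y 2 * w 6 + y 3 * w 7 + y 4 * w 0 + y 5 * w 1 + y 6 * w 2 - y 7 * w 3,
    y 0 * w 5 + y 1 * w 4 + y 2 * w 7 + y 3 * w 6 - y 4 * w 1 + y 5 * w 0 - y 6 * w 3 - y 7 * w 2,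
    y 0 * w 6 - y 1 * w 7 + y 2 * w 4 - y 3 * w 5 - y 4 * w 2 + y 5 * w 3 + y 6 * w 0 + y 7 * w 1,
    y 0 * w 7 + y 1 * w 6 - y 2 * w 5 - y 3 * w 4 + y 4 * w 3 + y 5 * w 2 - y 6 * w 1 + y 7 * w 0]

/-- Octonion conjugation. -/
def octConj (z : E8) : E8 := !₂[z 0, -z 1, -z 2, -z 3, -z 4, -z 5, -z 6, -z 7]

theorem norm_octMul (y w : E8) : ‖octMul y w‖ = ‖y‖ * ‖w‖ := by
  rw [← sq_eq_sq₀ (norm_nonneg _) (by positivity), mul_pow]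
  simp only [EuclideanSpace.real_norm_sq_eq, Fin.sum_univ_eight, octMul]
  simp only [Matrix.cons_val]
  ring

theorem norm_octConj (z : E8) : ‖octConj z‖ = ‖z‖ := by
  rw [← sq_eq_sq₀ (norm_nonneg _) (norm_nonneg _)]
  simp only [EuclideanSpace.real_norm_sq_eq, Fin.sum_univ_eight, octConj]
  simp only [Matrix.cons_val]
  ring

theorem wedge4_apply (a b c d : Fin 8) (v : Fin 4 → E8) :
    wedge4 a b c d v = (Matrix.of fun i j => v i (![a, b, c, d] j)).det := rfl

theorem wedge4_apply_cons (a b c d : Fin 8) (x y z w : E8) :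
    wedge4 a b c d ![x, y, z, w] =
      x a * (y b * (z c * w d - z d * w c) - y c * (z b * w d - z d * w b)
        + y d * (z b * w c - z c * w b))
      - x b * (y a * (z c * w d - z d * w c) - y c * (z a * w d - z d * w a)
        + y d * (z a * w c - z c * w a))
      + x c * (y a * (z b * w d - z d * w b) - y b * (z a * w d - z d * w a)
        + y d * (z a * w b - z b * w a))
      - x d * (y a * (z b * w c - z c * w b) - y b * (z a * w c - z c * w a)
        + y c * (z a * w b - z b * w a)) := by
  rw [wedge4_apply, Matrix.det_succ_row_zero, Fin.sum_univ_four]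
  simp only [Matrix.det_fin_three]
  simp [Fin.succAbove, Fin.lt_def]
  ring

/-- The triple cross product of `ℝ⁸`, dual to the Cayley form. -/
def tripleCross (y z w : E8) : E8 := WithLp.toLp 2 fun i => cay ![stdB i, y, z, w]

theorem Form4.apply_eq_sum (ω : Form4) (x y z w : E8) :
    ω ![x, y, z, w] = ∑ i, x i * ω ![stdB i, y, z, w] := by
  have hx : x = ∑ i, x i • stdB i := by
    ext j
    simp [stdB, Finset.sum_apply, Pi.single_apply]
  have h : ∀ u, ω ![u, y, z, w] = ω.toMultilinearMap.curryLeft u ![y, z, w] := fun _ => rfl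
  simp only [h]
  conv_lhs => rw [hx]
  simp

theorem cay_eq_inner (x y z w : E8) : cay ![x, y, z, w] = inner ℝ x (tripleCross y z w) := by
  rw [Form4.apply_eq_sum]
  simp [tripleCross, PiLp.inner_apply, mul_comm]

theorem tripleCross_add_eq_octMul (y z w : E8) :
    tripleCross y z w +
        (inner ℝ y z • w + inner ℝ z w • y - inner ℝ y w • z) =
      octMul (octMul y (octConj z)) w := by
  ext i
  simp only [tripleCross, PiLp.add_apply, PiLp.sub_apply, PiLp.smul_apply, PiLp.inner_apply,
    smul_eq_mul, Fin.sum_univ_eight, cay, E1234, E1256, E1278, E1357, E1368, E1458, E1467,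
    AlternatingMap.add_apply, AlternatingMap.sub_apply, wedge4_apply_cons, octMul, octConj, stdB,
    PiLp.toLp_apply, PiLp.single_apply, RCLike.inner_apply, conj_trivial]
  fin_cases i <;> simp [-mul_eq_mul_left_iff, -mul_eq_mul_right_iff] <;> ring

theorem norm_tripleCross_le (y z w : E8) : ‖tripleCross y z w‖ ≤ ‖y‖ * ‖z‖ * ‖w‖ := by
  set s : E8 := inner ℝ y z • w + inner ℝ z w • y - inner ℝ y w • z
  have hy : inner ℝ y (tripleCross y z w) = 0 := by
    rw [← cay_eq_inner]
    exact cay.map_eq_zero_of_eq _ (i := 0) (j := 1) rfl (by decide)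
  have hz : inner ℝ z (tripleCross y z w) = 0 := by
    rw [← cay_eq_inner]
    exact cay.map_eq_zero_of_eq _ (i := 0) (j := 2) rfl (by decide)
  have hw : inner ℝ w (tripleCross y z w) = 0 := by
    rw [← cay_eq_inner]
    exact cay.map_eq_zero_of_eq _ (i := 0) (j := 3) rfl (by decide)
  have hs : inner ℝ (tripleCross y z w) s = 0 := by
    rw [real_inner_comm]
    simp [s, inner_add_left, inner_sub_left, inner_smul_left, hy, hz, hw]
  have hnorm : ‖tripleCross y z w + s‖ = ‖y‖ * ‖z‖ * ‖w‖ := by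
    rw [tripleCross_add_eq_octMul, norm_octMul, norm_octMul, norm_octConj]
  rw [← hnorm, ← sq_le_sq₀ (norm_nonneg _) (norm_nonneg _), norm_add_sq_real, hs]
  nlinarith [sq_nonneg ‖s‖]

theorem abs_cay_le (v : Fin 4 → E8) (hv : ∀ i, ‖v i‖ = 1) : |cay v| ≤ 1 := by
  have hv' : v = ![v 0, v 1, v 2, v 3] := by
    ext i : 1
    fin_cases i <;> rfl
  rw [hv', cay_eq_inner]
  refine (abs_real_inner_le_norm _ _).trans ?_
  have h := norm_tripleCross_le (v 1) (v 2) (v 3)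
  simpa [hv] using h

/-- Rescaling of the coordinates of `ℝ⁸`. -/
def coordScale (s : Fin 8 → ℝ) (x : E8) : E8 := WithLp.toLp 2 fun j => s j * x j

theorem norm_coordScale {s : Fin 8 → ℝ} (hs : ∀ j, s j ^ 2 = 1) (x : E8) :
    ‖coordScale s x‖ = ‖x‖ := by
  rw [← sq_eq_sq₀ (norm_nonneg _) (norm_nonneg _)]
  simp [EuclideanSpace.real_norm_sq_eq, coordScale, mul_pow, hs]

theorem wedge4_coordScale (s : Fin 8 → ℝ) (a b c d : Fin 8) (v : Fin 4 → E8) :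
    wedge4 a b c d (fun i => coordScale s (v i)) =
      s a * s b * s c * s d * wedge4 a b c d v := by
  rw [wedge4_apply, wedge4_apply]
  have h := Matrix.det_mul_row (fun j => s (![a, b, c, d] j))
    (Matrix.of fun i j => v i (![a, b, c, d] j))
  simpa [Fin.prod_univ_four, coordScale] using h

/-- A form that takes the value `1` on `e₁, …, e₄` and is, up to sign, a rescaling of the Cayley
form by coordinate signs has comass `1`. -/
theorem comass_eq_one_of_coordScale {ω : Form4} (s : Fin 8 → ℝ) (ε : ℝ)
    (hs : ∀ j, s j ^ 2 = 1) (hε : |ε| = 1)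
    (hω : ∀ v, ω v = ε * cay (fun i => coordScale s (v i)))
    (h1 : ω ![stdB 0, stdB 1, stdB 2, stdB 3] = 1) : comass ω = 1 := by
  refine IsGreatest.csSup_eq ⟨⟨_, fun i => ?_, h1⟩, ?_⟩
  · fin_cases i <;> simp [stdB]
  · rintro r ⟨v, hv, rfl⟩
    rw [hω]
    refine (le_abs_self _).trans ?_
    rw [abs_mul, hε, one_mul]
    exact abs_cay_le _ fun i => by rw [norm_coordScale hs, hv]

/-- Each of the eight forms `ω₁ = cay, ω₂, ω₃, ω₄, η₁, η₂, η₃, η₄` has comass exactly `1`. -/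
theorem eight_forms_comass_one : ∀ i : Fin 8, comass (forms8 i) = 1 := by
  let signs : Fin 8 → Fin 8 → ℝ := ![1, ![1, 1, 1, 1, 1, 1, -1, -1], ![1, 1, 1, 1, 1, -1, 1, -1],
    ![1, 1, 1, 1, 1, -1, -1, 1], ![1, 1, 1, -1, 1, 1, -1, 1], ![1, 1, 1, -1, 1, 1, 1, -1],
    ![1, 1, 1, -1, -1, 1, 1, 1], ![1, 1, 1, -1, 1, -1, 1, 1]]
  let ε : Fin 8 → ℝ := ![1, 1, 1, 1, -1, -1, -1, -1]
  intro i
  refine comass_eq_one_of_coordScale (signs i) (ε i) (fun j => ?_) ?_ (fun v => ?_) ?_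
  · fin_cases i <;> fin_cases j <;> simp [signs]
  · fin_cases i <;> simp [ε]
  · fin_cases i <;>
      simp [forms8, cay, omega2, omega3, omega4, eta1, eta2, eta3, eta4, E1234, E1256, E1278,
        E1357, E1368, E1458, E1467, wedge4_coordScale, signs, ε] <;> ring
  · fin_cases i <;>
      simp [forms8, cay, omega2, omega3, omega4, eta1, eta2, eta3, eta4, E1234, E1256, E1278,
        E1357, E1368, E1458, E1467, wedge4_apply_cons, stdB]
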